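/- Let G be a discrete group, Λ ⊆ G, and C ≥ 1. Then Λ is completely Sidon with constant C if and only if for every complex Hilbert space H and every function z : Λ → (H →L[ℂ] H) with sup_{t∈Λ} ‖z t‖ ≤ 1, there exist a complex Hilbert space Ĥ, a unitary representation π of G on Ĥ, and bounded operators ξ, η : H →L[ℂ] Ĥ with ‖ξ‖·‖η‖ ≤ C such that (adjoint η) ∘ π(t) ∘ ξ = z t for every t ∈ Λ. -/

import Mathlib

/-- The operator `Op(a,v)` on the ℓ²-direct sum of `N` copies of `H`. -/
noncomputable def sidonOp {G : Type} {Λ : Set G} {N : ℕ}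
    (a : ↥Λ →₀ Matrix (Fin N) (Fin N) ℂ)
    {H : Type} [NormedAddCommGroup H] [InnerProductSpace ℂ H]
    (v : ↥Λ → H →L[ℂ] H) :
    PiLp 2 (fun _ : Fin N => H) →L[ℂ] PiLp 2 (fun _ : Fin N => H) :=
  (((PiLp.continuousLinearEquiv 2 ℂ (fun _ : Fin N => H)).symm :
      (Fin N → H) →L[ℂ] PiLp 2 (fun _ : Fin N => H)).comp
    ((ContinuousLinearMap.pi fun i =>
        ∑ t ∈ a.support, ∑ j, (a t i j) • ((v t).comp (ContinuousLinearMap.proj j))).comp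
      (((PiLp.continuousLinearEquiv 2 ℂ (fun _ : Fin N => H)) :
        PiLp 2 (fun _ : Fin N => H) →L[ℂ] (Fin N → H)))))

/-- `Λ ⊆ G` is completely Sidon with constant `C`. -/
def IsCompletelySidon {G : Type} [Group G] (Λ : Set G) (C : ℝ) : Prop :=
  ∀ (N : ℕ) (a : ↥Λ →₀ Matrix (Fin N) (Fin N) ℂ) (D : ℝ), 0 ≤ D →
    (∀ (H' : Type) [NormedAddCommGroup H'] [InnerProductSpace ℂ H'] [CompleteSpace H']
        (π : G →* unitary (H' →L[ℂ] H')),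
        ‖sidonOp a (fun t => ((π (t : G) : unitary (H' →L[ℂ] H')) : H' →L[ℂ] H'))‖ ≤ D) →
    ∀ (K : Type) [NormedAddCommGroup K] [InnerProductSpace ℂ K] [CompleteSpace K]
      (u : ↥Λ → unitary (K →L[ℂ] K)),
      ‖sidonOp a (fun t => ((u t : unitary (K →L[ℂ] K)) : K →L[ℂ] K))‖ ≤ C * D

/-- The sesquilinear form attached to a scalar matrix. -/
noncomputable def sform {N : ℕ} {K : Type} [NormedAddCommGroup K] [InnerProductSpace ℂ K]
    (M : Matrix (Fin N) (Fin N) ℂ) (x y : Fin N → K) : ℂ :=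
  ∑ i, ∑ j, M i j * inner ℂ (x i) (y j)

/-- The sesquilinear form of `sidonOp`. -/
noncomputable def bform {G : Type} {Λ : Set G} {N : ℕ} {K : Type} [NormedAddCommGroup K]
    [InnerProductSpace ℂ K]
    (a : ↥Λ →₀ Matrix (Fin N) (Fin N) ℂ) (v : ↥Λ → K →L[ℂ] K) (x y : Fin N → K) : ℂ :=
  ∑ t ∈ a.support, sform (a t) x (fun j => v t (y j))

/-- Action of a scalar matrix on a tuple of vectors. -/
noncomputable def mact {N : ℕ} {K : Type} [NormedAddCommGroup K] [InnerProductSpace ℂ K]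
    (M : Matrix (Fin N) (Fin N) ℂ) (x : Fin N → K) : Fin N → K :=
  fun i => ∑ j, M i j • x j

/-- The square of the l2 norm of a tuple. -/
noncomputable def nsq {N : ℕ} {K : Type} [NormedAddCommGroup K]
    (x : Fin N → K) : ℝ := ∑ i, ‖x i‖ ^ 2

section basics
variable {G : Type} {Λ : Set G} {N : ℕ} {K : Type} [NormedAddCommGroup K] [InnerProductSpace ℂ K]

theorem inner_sidonOp (a : ↥Λ →₀ Matrix (Fin N) (Fin N) ℂ) (v : ↥Λ → K →L[ℂ] K)
    (x y : PiLp 2 (fun _ : Fin N => K)) :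
    inner ℂ x (sidonOp a v y) = bform a v (fun i => x i) (fun i => y i) := by
  unfold bform sform sidonOp
  rw [PiLp.inner_apply]
  rw [Finset.sum_comm]
  refine Finset.sum_congr rfl fun i _ => ?_
  simp [inner_sum, inner_smul_right]

theorem norm_sq_eq_nsq (x : PiLp 2 (fun _ : Fin N => K)) : ‖x‖ ^ 2 = nsq (fun i => x i) := by
  rw [PiLp.norm_sq_eq_of_L2]; rfl

theorem sform_mact_right (M A : Matrix (Fin N) (Fin N) ℂ) (x y : Fin N → K) :
    sform M x (mact A y) = sform (M * A) x y := by
  unfold sform mact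
  refine Finset.sum_congr rfl fun i _ => ?_
  simp only [inner_sum, inner_smul_right, Matrix.mul_apply, Finset.sum_mul, Finset.mul_sum]
  rw [Finset.sum_comm]
  simp only [mul_assoc]

theorem sform_conjTranspose (A : Matrix (Fin N) (Fin N) ℂ) (x y : Fin N → K) :
    sform A.conjTranspose x y = starRingEnd ℂ (sform A y x) := by
  unfold sform
  rw [Finset.sum_comm]
  simp [map_sum]

theorem sform_mact (M A B : Matrix (Fin N) (Fin N) ℂ) (x y : Fin N → K) :
    sform M (mact B x) (mact A y) = sform (B.conjTranspose * M * A) x y := by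
  rw [sform_mact_right, ← Matrix.conjTranspose_conjTranspose (M * A), sform_conjTranspose,
    sform_mact_right, ← sform_conjTranspose, Matrix.conjTranspose_mul,
    Matrix.conjTranspose_conjTranspose, Matrix.mul_assoc]

theorem mact_mact (A B : Matrix (Fin N) (Fin N) ℂ) (x : Fin N → K) :
    mact A (mact B x) = mact (A * B) x := by
  unfold mact
  funext i
  simp only [Finset.smul_sum, Matrix.mul_apply, Finset.sum_smul, smul_smul]
  rw [Finset.sum_comm]

theorem mact_one (x : Fin N → K) : mact 1 x = x := by
  unfold mact
  funext i
  simp [Matrix.one_apply]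

theorem map_mact {K' : Type} [NormedAddCommGroup K'] [InnerProductSpace ℂ K'] (f : K →L[ℂ] K')
    (A : Matrix (Fin N) (Fin N) ℂ) (x : Fin N → K) :
    (fun j => f (mact A x j)) = mact A (fun j => f (x j)) := by
  unfold mact
  funext i
  simp

theorem sform_one (x : Fin N → K) : sform 1 x x = (nsq x : ℂ) := by
  unfold sform nsq
  simp [Matrix.one_apply]

theorem sform_add (A B : Matrix (Fin N) (Fin N) ℂ) (x y : Fin N → K) :
    sform (A + B) x y = sform A x y + sform B x y := by
  unfold sform
  simp [add_mul, Finset.sum_add_distrib]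

theorem sform_smul (c : ℂ) (A : Matrix (Fin N) (Fin N) ℂ) (x y : Fin N → K) :
    sform (c • A) x y = c * sform A x y := by
  unfold sform
  simp [Finset.mul_sum, mul_assoc]

theorem norm_sidonOp_le_two (a : ↥Λ →₀ Matrix (Fin N) (Fin N) ℂ) (v : ↥Λ → K →L[ℂ] K)
    (h : ∀ x y : Fin N → K, 0 ≤ nsq x + nsq y + (bform a v x y).re) : ‖sidonOp a v‖ ≤ 2 := by
  refine ContinuousLinearMap.opNorm_le_bound _ (by norm_num) fun y => ?_
  have h1 := h (fun i => ((-(1/2:ℂ)) • sidonOp a v y : PiLp 2 (fun _ : Fin N => K)) i) (fun i => y i)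
  rw [← inner_sidonOp, ← norm_sq_eq_nsq, ← norm_sq_eq_nsq, inner_smul_left,
    inner_self_eq_norm_sq_to_K, norm_smul] at h1
  have h2 : ((starRingEnd ℂ) (-(1/2:ℂ)) * (((‖sidonOp a v y‖ : ℝ) : ℂ)) ^ 2).re
      = - (1/2) * ‖sidonOp a v y‖ ^ 2 := by
    rw [← Complex.ofReal_pow, Complex.re_mul_ofReal]; simp
  have h3 : ‖(-(1/2:ℂ))‖ = 1/2 := by simp
  rw [h3] at h1
  erw [h2] at h1
  refine abs_le_of_sq_le_sq' ?_ (by positivity) |>.2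
  nlinarith

theorem re_bform_of_norm (a : ↥Λ →₀ Matrix (Fin N) (Fin N) ℂ) (v : ↥Λ → K →L[ℂ] K) (R : ℝ)
    (hR : ‖sidonOp a v‖ ≤ R * 2) (x y : Fin N → K) :
    0 ≤ R * (nsq x + nsq y) + (bform a v x y).re := by
  have h := inner_sidonOp a v (WithLp.toLp 2 x) (WithLp.toLp 2 y)
  have hx := norm_sq_eq_nsq (WithLp.toLp 2 x)
  have hy := norm_sq_eq_nsq (WithLp.toLp 2 y)
  simp only at h hx hy
  rw [← h, ← hx, ← hy]
  set X := WithLp.toLp 2 x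
  set Y := WithLp.toLp 2 y
  have h1 : ‖inner ℂ X (sidonOp a v Y)‖ ≤ ‖X‖ * (R * 2 * ‖Y‖) :=
    (norm_inner_le_norm _ _).trans (by gcongr; exact ContinuousLinearMap.le_of_opNorm_le _ hR _)
  have h2 := neg_le_of_abs_le (Complex.abs_re_le_norm (inner ℂ X (sidonOp a v Y)))
  have hR0 : 0 ≤ R := by linarith [norm_nonneg (sidonOp a v)]
  nlinarith [mul_nonneg hR0 (sq_nonneg (‖X‖ - ‖Y‖))]

end basics

theorem exists_unitary_avg {L : Type} [NormedAddCommGroup L] [InnerProductSpace ℂ L]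
    [CompleteSpace L] (A : L →L[ℂ] L) (hA : IsSelfAdjoint A) (h1 : ‖A‖ ≤ 1) :
    ∃ u : unitary (L →L[ℂ] L),
      (u : L →L[ℂ] L) + ((star u : unitary (L →L[ℂ] L)) : L →L[ℂ] L) = (2 : ℂ) • A := by
  let a : selfAdjoint (L →L[ℂ] L) := ⟨A, hA⟩
  have h1a : ‖a‖ ≤ 1 := h1
  refine ⟨selfAdjoint.unitarySelfAddISMul a h1a, ?_⟩
  have h2 := selfAdjoint.star_coe_unitarySelfAddISMul a h1a
  rw [Unitary.coe_star, h2, selfAdjoint.unitarySelfAddISMul_coe, two_smul]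
  simp [a]

/-- The self-adjoint `2 × 2` operator matrix with off-diagonal entries `z` and its adjoint. -/
noncomputable def offDiag {H : Type} [NormedAddCommGroup H] [InnerProductSpace ℂ H]
    [CompleteSpace H] (z : H →L[ℂ] H) : WithLp 2 (H × H) →L[ℂ] WithLp 2 (H × H) :=
  ((WithLp.prodContinuousLinearEquiv 2 ℂ H H).symm : H × H →L[ℂ] WithLp 2 (H × H)).comp
    (((z.comp (ContinuousLinearMap.snd ℂ H H)).prod
      ((ContinuousLinearMap.adjoint z).comp (ContinuousLinearMap.fst ℂ H H))).comp
      ((WithLp.prodContinuousLinearEquiv 2 ℂ H H) : WithLp 2 (H × H) →L[ℂ] H × H))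

section contr
variable {H : Type} [NormedAddCommGroup H] [InnerProductSpace ℂ H] [CompleteSpace H]

theorem offDiag_apply (z : H →L[ℂ] H) (x : WithLp 2 (H × H)) :
    offDiag z x = WithLp.toLp 2 (z x.snd, ContinuousLinearMap.adjoint z x.fst) := rfl

theorem offDiag_selfAdjoint (z : H →L[ℂ] H) : IsSelfAdjoint (offDiag z) := by
  rw [ContinuousLinearMap.isSelfAdjoint_iff_isSymmetric]
  intro x y
  simp only [ContinuousLinearMap.coe_coe, offDiag_apply, WithLp.prod_inner_apply,
    ContinuousLinearMap.adjoint_inner_left, ContinuousLinearMap.adjoint_inner_right]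
  exact add_comm _ _

theorem offDiag_norm (z : H →L[ℂ] H) (hz : ‖z‖ ≤ 1) : ‖offDiag z‖ ≤ 1 := by
  refine ContinuousLinearMap.opNorm_le_bound _ zero_le_one fun x => ?_
  rw [one_mul]
  refine abs_le_of_sq_le_sq' ?_ (by positivity) |>.2
  rw [WithLp.prod_norm_sq_eq_of_L2, WithLp.prod_norm_sq_eq_of_L2, offDiag_apply]
  have h1 : ‖z x.snd‖ ≤ ‖x.snd‖ := by simpa using z.le_of_opNorm_le hz x.snd
  have h2 : ‖ContinuousLinearMap.adjoint z x.fst‖ ≤ ‖x.fst‖ := by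
    have h0 : ‖ContinuousLinearMap.adjoint z‖ ≤ 1 := by
      rw [LinearIsometryEquiv.norm_map]; exact hz
    simpa using (ContinuousLinearMap.adjoint z).le_of_opNorm_le h0 x.fst
  have h3 := pow_le_pow_left₀ (norm_nonneg _) h1 2
  have h4 := pow_le_pow_left₀ (norm_nonneg _) h2 2
  change ‖z x.snd‖ ^ 2 + ‖ContinuousLinearMap.adjoint z x.fst‖ ^ 2 ≤ _
  linarith

theorem contr_bound {G : Type} [Group G] {Λ : Set G} {C : ℝ} (hS : IsCompletelySidon Λ C)
    {N : ℕ} (a : ↥Λ →₀ Matrix (Fin N) (Fin N) ℂ)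
    (ha : ∀ (H' : Type) [NormedAddCommGroup H'] [InnerProductSpace ℂ H'] [CompleteSpace H']
        (π : G →* unitary (H' →L[ℂ] H')),
        ‖sidonOp a (fun t => ((π (t : G) : unitary (H' →L[ℂ] H')) : H' →L[ℂ] H'))‖ ≤ 2)
    (z : ↥Λ → H →L[ℂ] H) (hz : ∀ t, ‖z t‖ ≤ 1) (x y : Fin N → H) :
    0 ≤ C * (nsq x + nsq y) + (bform a z x y).re := by
  choose u hu using fun t => exists_unitary_avg (offDiag (z t)) (offDiag_selfAdjoint _)
    (offDiag_norm _ (hz t))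
  have hb := hS N a 2 (by norm_num) ha (WithLp 2 (H × H))
  let X : Fin N → WithLp 2 (H × H) := fun i => WithLp.toLp 2 (x i, 0)
  let Y : Fin N → WithLp 2 (H × H) := fun i => WithLp.toLp 2 (0, y i)
  have h1 := re_bform_of_norm a _ C (hb u) X Y
  have h2 := re_bform_of_norm a _ C (hb (fun t => star (u t))) X Y
  have hX : nsq X = nsq x := by
    unfold nsq
    refine Finset.sum_congr rfl fun i _ => ?_
    rw [WithLp.prod_norm_sq_eq_of_L2]; simp [X]
  have hY : nsq Y = nsq y := by
    unfold nsq
    refine Finset.sum_congr rfl fun i _ => ?_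
    rw [WithLp.prod_norm_sq_eq_of_L2]; simp [Y]
  have h3 : bform a (fun t => (u t : WithLp 2 (H × H) →L[ℂ] WithLp 2 (H × H))) X Y
      + bform a (fun t => ((star (u t) : unitary _) : WithLp 2 (H × H) →L[ℂ] WithLp 2 (H × H))) X Y
      = 2 * bform a z x y := by
    unfold bform sform
    simp only [← Finset.sum_add_distrib, Finset.mul_sum]
    refine Finset.sum_congr rfl fun t _ => Finset.sum_congr rfl fun i _ =>
      Finset.sum_congr rfl fun j _ => ?_
    rw [← mul_add, ← inner_add_right, ← add_apply, hu t]
    simp only [smul_apply, inner_smul_right, offDiag_apply,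
      WithLp.prod_inner_apply, X, Y]
    simp
    ring
  have h4 := congrArg Complex.re h3
  rw [hX, hY] at h1 h2
  simp only [Complex.add_re, Complex.mul_re, Complex.re_ofNat, Complex.im_ofNat, zero_mul,
    sub_zero] at h4
  linarith

end contr

theorem easy_direction {G : Type} [Group G] (Λ : Set G) (C : ℝ)
    (h : ∀ (H : Type) [NormedAddCommGroup H] [InnerProductSpace ℂ H] [CompleteSpace H]
        (z : ↥Λ → H →L[ℂ] H), (∀ t, ‖z t‖ ≤ 1) →
        ∃ (K : Type) (_ : NormedAddCommGroup K) (_ : InnerProductSpace ℂ K) (_ : CompleteSpace K)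
          (π : G →* unitary (K →L[ℂ] K)) (ξ η : H →L[ℂ] K),
          ‖ξ‖ * ‖η‖ ≤ C ∧
          ∀ t : ↥Λ,
            (ContinuousLinearMap.adjoint η).comp
              (((π (t : G) : unitary (K →L[ℂ] K)) : K →L[ℂ] K).comp ξ) = z t) :
    IsCompletelySidon Λ C := by
  intro N a D hD hπ K _ _ _ u
  obtain ⟨L, _, _, _, π, ξ, η, hn, he⟩ := h K (fun t => (u t : K →L[ℂ] K)) (fun t => by
    refine ContinuousLinearMap.opNorm_le_bound _ zero_le_one fun x => ?_
    rw [one_mul]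
    exact (ContinuousLinearMap.norm_map_of_mem_unitary (u t).2 x).le)
  have hD' := hπ L π
  have hC : 0 ≤ C := le_trans (by positivity) hn
  refine ContinuousLinearMap.opNorm_le_bound _ (by positivity) fun y => ?_
  set x := sidonOp a (fun t => (u t : K →L[ℂ] K)) y with hx
  have lift : ∀ (f : K →L[ℂ] L) (w : PiLp 2 (fun _ : Fin N => K)),
      ‖(WithLp.toLp 2 (fun i => f (w i)) : PiLp 2 (fun _ : Fin N => L))‖ ≤ ‖f‖ * ‖w‖ := by
    intro f w
    refine abs_le_of_sq_le_sq' ?_ (by positivity) |>.2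
    rw [mul_pow, PiLp.norm_sq_eq_of_L2, PiLp.norm_sq_eq_of_L2, Finset.mul_sum]
    refine Finset.sum_le_sum fun i _ => ?_
    rw [← mul_pow]
    exact pow_le_pow_left₀ (norm_nonneg _) (f.le_opNorm _) 2
  have key : inner ℂ x (sidonOp a (fun t => (u t : K →L[ℂ] K)) y)
      = inner ℂ (WithLp.toLp 2 (fun i => η (x i)) : PiLp 2 (fun _ : Fin N => L))
        (sidonOp a (fun t => ((π (t : G) : unitary (L →L[ℂ] L)) : L →L[ℂ] L))
          (WithLp.toLp 2 (fun i => ξ (y i)))) := by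
    rw [inner_sidonOp, inner_sidonOp]
    unfold bform sform
    refine Finset.sum_congr rfl fun t _ => Finset.sum_congr rfl fun i _ =>
      Finset.sum_congr rfl fun j _ => ?_
    have e1 : (u t : K →L[ℂ] K) (y j) = ContinuousLinearMap.adjoint η
        (((π (t : G) : unitary (L →L[ℂ] L)) : L →L[ℂ] L) (ξ (y j))) := by
      rw [← he t]; rfl
    simp only [e1, ContinuousLinearMap.adjoint_inner_right]
  have h1 : ‖x‖ * ‖x‖ ≤ ‖x‖ * (C * D * ‖y‖) := by
    calc ‖x‖ * ‖x‖ = ‖inner ℂ x x‖ := by simp [inner_self_eq_norm_sq_to_K, sq]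
      _ ≤ (‖η‖ * ‖x‖) * (D * (‖ξ‖ * ‖y‖)) := by
        nth_rewrite 2 [hx]
        rw [key]
        refine (norm_inner_le_norm _ _).trans ?_
        gcongr
        · exact lift η x
        · refine (ContinuousLinearMap.le_of_opNorm_le _ hD' _).trans ?_
          gcongr
          exact lift ξ y
      _ = (‖ξ‖ * ‖η‖) * (‖x‖ * D * ‖y‖) := by ring
      _ ≤ C * (‖x‖ * D * ‖y‖) := by gcongr
      _ = _ := by ring
  rcases (norm_nonneg x).eq_or_lt with h0 | h0
  · rw [← h0]; positivity
  · exact le_of_mul_le_mul_left h1 h0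

open scoped ComplexOrder in
theorem posdef_factor {N : ℕ} (M : Matrix (Fin N) (Fin N) ℂ) (hM : M.PosDef) :
    ∃ α α' : Matrix (Fin N) (Fin N) ℂ, M = α.conjTranspose * α ∧ α * α' = 1 ∧ α' * α = 1 := by
  obtain ⟨B, hB⟩ : ∃ B : Matrix (Fin N) (Fin N) ℂ, M = B.conjTranspose * B := by
    open scoped MatrixOrder in
    open scoped Matrix.Norms.L2Operator in
    exact CStarAlgebra.nonneg_iff_eq_star_mul_self.mp hM.posSemidef.nonneg
  have hu : IsUnit M := hM.isUnit
  have hd : IsUnit B.det := by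
    rw [Matrix.isUnit_iff_isUnit_det, hB, Matrix.det_mul] at hu
    exact isUnit_of_mul_isUnit_right hu
  exact ⟨B, B⁻¹, hB, Matrix.mul_nonsing_inv _ hd, Matrix.nonsing_inv_mul _ hd⟩

theorem nsq_eq_sform {N : ℕ} {K : Type} [NormedAddCommGroup K] [InnerProductSpace ℂ K]
    (α : Matrix (Fin N) (Fin N) ℂ) (x : Fin N → K) :
    sform (α.conjTranspose * α) x x = (nsq (mact α x) : ℂ) := by
  rw [← sform_one, sform_mact, Matrix.mul_one]

open scoped ComplexOrder in
theorem hermitian_factor {N : ℕ} (A : Matrix (Fin N) (Fin N) ℂ)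
    (hA : ∀ x : Fin N → ℂ, 0 ≤ (sform A x x).re) (ε : ℝ) (hε : 0 < ε) :
    ∃ α α' : Matrix (Fin N) (Fin N) ℂ, α * α' = 1 ∧ α' * α = 1 ∧
      ∀ (K : Type) [NormedAddCommGroup K] [InnerProductSpace ℂ K] (x : Fin N → K),
        (sform A x x).re + ε * nsq x = nsq (mact α x) := by
  let M : Matrix (Fin N) (Fin N) ℂ := (1 / 2 : ℂ) • (A + A.conjTranspose) + (ε : ℂ) • 1
  have hform : ∀ (K : Type) [NormedAddCommGroup K] [InnerProductSpace ℂ K] (x : Fin N → K),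
      sform M x x = (((sform A x x).re + ε * nsq x : ℝ) : ℂ) := by
    intro K _ _ x
    simp only [M]
    rw [sform_add, sform_smul, sform_smul, sform_add, sform_conjTranspose, sform_one,
      Complex.add_conj]
    push_cast
    ring
  have hM : M.PosDef := by
    refine Matrix.PosDef.of_dotProduct_mulVec_pos ?_ ?_
    · simp only [M, Matrix.IsHermitian]
      rw [Matrix.conjTranspose_add, Matrix.conjTranspose_smul, Matrix.conjTranspose_smul,
        Matrix.conjTranspose_add, Matrix.conjTranspose_conjTranspose, Matrix.conjTranspose_one,
        add_comm A.conjTranspose A]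
      simp
    · intro x hx
      have h1 : dotProduct (star x) (Matrix.mulVec M x) = sform M x x := by
        unfold sform
        simp only [dotProduct, Matrix.mulVec, Finset.mul_sum]
        refine Finset.sum_congr rfl fun i _ => Finset.sum_congr rfl fun j _ => ?_
        simp
        ring
      rw [h1, hform]
      have h2 : 0 < nsq x := by
        obtain ⟨i, hi⟩ := Function.ne_iff.mp hx
        exact Finset.sum_pos' (fun i _ => by positivity)
          ⟨i, Finset.mem_univ _, by have := norm_pos_iff.mpr hi; positivity⟩
      have h3 := hA x
      have : 0 < (sform A x x).re + ε * nsq x := by positivity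
      exact_mod_cast this
  obtain ⟨α, α', h1, h2, h3⟩ := posdef_factor M hM
  refine ⟨α, α', h2, h3, fun K _ _ x => ?_⟩
  have h4 := hform K x
  rw [h1, nsq_eq_sform] at h4
  exact_mod_cast h4.symm

theorem nsq_nonneg {N : ℕ} {K : Type} [NormedAddCommGroup K] (x : Fin N → K) : 0 ≤ nsq x :=
  Finset.sum_nonneg fun _ _ => by positivity

theorem core_ineq {G : Type} [Group G] {Λ : Set G} {C : ℝ} (hS : IsCompletelySidon Λ C)
    {N : ℕ} (A B : Matrix (Fin N) (Fin N) ℂ) (a : ↥Λ →₀ Matrix (Fin N) (Fin N) ℂ)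
    (ha : ∀ (K : Type) [NormedAddCommGroup K] [InnerProductSpace ℂ K] [CompleteSpace K]
        (π : G →* unitary (K →L[ℂ] K)) (x y : Fin N → K),
        0 ≤ (sform A y y + sform B x x +
          bform a (fun t => ((π (t : G) : unitary (K →L[ℂ] K)) : K →L[ℂ] K)) x y).re)
    {H : Type} [NormedAddCommGroup H] [InnerProductSpace ℂ H] [CompleteSpace H]
    (z : ↥Λ → H →L[ℂ] H) (hz : ∀ t, ‖z t‖ ≤ 1) (x y : Fin N → H) :
    0 ≤ (C * sform A y y + C * sform B x x + bform a z x y).re := by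
  have hb0 : ∀ (v : ↥Λ → ℂ →L[ℂ] ℂ) (x : Fin N → ℂ), bform a v x 0 = 0 := by
    intro v x; simp [bform, sform]
  have hb1 : ∀ (v : ↥Λ → ℂ →L[ℂ] ℂ) (x : Fin N → ℂ), bform a v 0 x = 0 := by
    intro v x; simp [bform, sform]
  have hs0 : ∀ (M : Matrix (Fin N) (Fin N) ℂ), sform M (0 : Fin N → ℂ) 0 = 0 := by
    intro M; simp [sform]
  have hA : ∀ x : Fin N → ℂ, 0 ≤ (sform A x x).re := by
    intro x
    simpa [hb1, hs0] using ha ℂ 1 0 x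
  have hB : ∀ x : Fin N → ℂ, 0 ≤ (sform B x x).re := by
    intro x
    simpa [hb0, hs0] using ha ℂ 1 x 0
  -- it suffices to prove the inequality up to `ε`
  have key : ∀ ε : ℝ, 0 < ε →
      0 ≤ (C * sform A y y + C * sform B x x + bform a z x y).re + ε * (C * (nsq x + nsq y)) := by
    intro ε hε
    obtain ⟨α, α', hα, hα', fα⟩ := hermitian_factor A hA ε hε
    obtain ⟨β, β', hβ, hβ', fβ⟩ := hermitian_factor B hB ε hε
    let a' : ↥Λ →₀ Matrix (Fin N) (Fin N) ℂ :=
      a.mapRange (fun M => β'.conjTranspose * M * α') (by simp)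
    have hbf : ∀ (K : Type) [NormedAddCommGroup K] [InnerProductSpace ℂ K]
        (v : ↥Λ → K →L[ℂ] K) (x y : Fin N → K),
        bform a' v x y = bform a v (mact β' x) (mact α' y) := by
      intro K _ _ v x y
      unfold bform
      have hsub : a'.support ⊆ a.support := Finsupp.support_mapRange
      rw [Finset.sum_subset hsub]
      · refine Finset.sum_congr rfl fun t _ => ?_
        rw [map_mact, sform_mact]
        rfl
      · intro t _ ht
        rw [Finsupp.notMem_support_iff.mp ht]
        simp [sform]
    have hn : ∀ (K : Type) [NormedAddCommGroup K] [InnerProductSpace ℂ K] [CompleteSpace K]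
        (π : G →* unitary (K →L[ℂ] K)),
        ‖sidonOp a' (fun t => ((π (t : G) : unitary (K →L[ℂ] K)) : K →L[ℂ] K))‖ ≤ 2 := by
      intro K _ _ _ π
      refine norm_sidonOp_le_two _ _ fun x y => ?_
      rw [hbf]
      have h1 := ha K π (mact β' x) (mact α' y)
      have h2 := fα K (mact α' y)
      have h3 := fβ K (mact β' x)
      rw [mact_mact, hα, mact_one] at h2
      rw [mact_mact, hβ, mact_one] at h3
      rw [← h2, ← h3]
      have h4 := nsq_nonneg (mact α' y)
      have h5 := nsq_nonneg (mact β' x)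
      simp only [Complex.add_re] at h1
      have h6 := mul_nonneg hε.le h4
      have h7 := mul_nonneg hε.le h5
      linarith
    have hc := contr_bound hS a' hn z hz (mact β x) (mact α y)
    rw [hbf, mact_mact, mact_mact, hα', hβ', mact_one, mact_one, ← fα, ← fβ] at hc
    simp only [Complex.add_re, Complex.re_ofReal_mul]
    linarith
  by_contra hneg
  push Not at hneg
  set r := (C * sform A y y + C * sform B x x + bform a z x y).re
  set q := C * (nsq x + nsq y)
  have h1 := key (-r / (2 * (|q| + 1))) (by have := abs_nonneg q; apply div_pos <;> linarith)
  have h2 : -r / (2 * (|q| + 1)) * q ≤ -r / 2 := by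
    have hq := abs_nonneg q
    have : -r / (2 * (|q| + 1)) * q = (-r / 2) * (q / (|q| + 1)) := by field_simp
    rw [this]
    have h3 : q / (|q| + 1) ≤ 1 := by
      rw [div_le_one (by linarith)]
      linarith [le_abs_self q]
    nlinarith
  linarith

section extension
variable {G : Type} [Group G] {ι : Type}

/-- The vector-state functional coefficients of a representation. -/
noncomputable def repCoef {K : Type} [NormedAddCommGroup K] [InnerProductSpace ℂ K]
    [CompleteSpace K] (π : G →* unitary (K →L[ℂ] K)) (y : ι → K) : G × ι × ι → ℂ :=
  fun p => inner ℂ (y p.2.1) (((π p.1 : unitary (K →L[ℂ] K)) : K →L[ℂ] K) (y p.2.2))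

/-- The cone of elements that are positive in every representation. -/
noncomputable def posCone (G : Type) [Group G] (ι : Type) : PointedCone ℝ ((G × ι × ι) →₀ ℂ) where
  carrier := {v | ∀ (K : Type) [NormedAddCommGroup K] [InnerProductSpace ℂ K] [CompleteSpace K]
    (π : G →* unitary (K →L[ℂ] K)) (y : ι → K),
    0 ≤ (Finsupp.linearCombination ℂ (repCoef π y) v).re}
  add_mem' := by
    intro v w hv hw K _ _ _ π y
    rw [map_add, Complex.add_re]
    exact add_nonneg (hv K π y) (hw K π y)
  zero_mem' := by
    intro K _ _ _ π y
    simp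
  smul_mem' := by
    intro c v hv K _ _ _ π y
    have h : c • v = ((c : ℝ) : ℂ) • v := by
      ext p
      simp [NNReal.smul_def]
    rw [h, map_smul, smul_eq_mul, Complex.re_ofReal_mul]
    exact mul_nonneg c.2 (hv K π y)

theorem mem_posCone (v : (G × ι × ι) →₀ ℂ) : v ∈ posCone G ι ↔
    ∀ (K : Type) [NormedAddCommGroup K] [InnerProductSpace ℂ K] [CompleteSpace K]
    (π : G →* unitary (K →L[ℂ] K)) (y : ι → K),
    0 ≤ (Finsupp.linearCombination ℂ (repCoef π y) v).re := Iff.rfl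

/-- The constrained coordinates. -/
def constrSet (Λ : Set G) (ι : Type) : Set (G × (ι ⊕ ι) × (ι ⊕ ι)) :=
  {p | (∃ i j, p = (1, Sum.inl i, Sum.inl j)) ∨ (∃ i j, p = (1, Sum.inr i, Sum.inr j)) ∨
    (∃ t ∈ Λ, ∃ i j, p = (t, Sum.inr i, Sum.inl j))}

open Classical in
/-- The prescribed values. -/
noncomputable def constrVal {H : Type} [NormedAddCommGroup H] [InnerProductSpace ℂ H]
    (Λ : Set G) (C : ℝ) (z : ↥Λ → H →L[ℂ] H) (b : ι → H) : G × (ι ⊕ ι) × (ι ⊕ ι) → ℂ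
  | (_, Sum.inl i, Sum.inl j) => C * inner ℂ (b i) (b j)
  | (_, Sum.inr i, Sum.inr j) => C * inner ℂ (b i) (b j)
  | (g, Sum.inr i, Sum.inl j) => if h : g ∈ Λ then inner ℂ (b i) (z ⟨g, h⟩ (b j)) else 0
  | (_, Sum.inl _, Sum.inr _) => 0

theorem expand_supported (Λ : Set G) (v : (G × (ι ⊕ ι) × (ι ⊕ ι)) →₀ ℂ)
    (hv : ∀ p, p ∉ constrSet Λ ι → v p = 0) :
    ∃ (N : ℕ) (e : Fin N → ι) (A B : Matrix (Fin N) (Fin N) ℂ)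
      (a : ↥Λ →₀ Matrix (Fin N) (Fin N) ℂ), Function.Injective e ∧
      ∀ c : G × (ι ⊕ ι) × (ι ⊕ ι) → ℂ, Finsupp.linearCombination ℂ c v =
        (∑ i, ∑ j, A i j * c (1, Sum.inl (e i), Sum.inl (e j))) +
        (∑ i, ∑ j, B i j * c (1, Sum.inr (e i), Sum.inr (e j))) +
        ∑ t ∈ a.support, ∑ i, ∑ j, a t i j * c ((t : G), Sum.inr (e i), Sum.inl (e j)) := by
  classical
  let s : Finset ι := v.support.image (fun p => Sum.elim id id p.2.1) ∪
    v.support.image (fun p => Sum.elim id id p.2.2)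
  let F : Finset G := insert 1 (v.support.image (fun p => p.1))
  let e : Fin s.card → ι := fun k => (s.equivFin.symm k : ι)
  have hsum : ∀ f : ι → ℂ, ∑ i ∈ s, f i = ∑ k, f (e k) := by
    intro f
    rw [← Finset.sum_coe_sort s f]
    exact (Equiv.sum_comp s.equivFin.symm (fun i : s => f i)).symm
  have hmem : ∀ x : ι ⊕ ι, Sum.elim id id x ∈ s → x ∈ s.disjSum s := by
    rintro (x | x) hx
    · exact Finset.inl_mem_disjSum.mpr hx
    · exact Finset.inr_mem_disjSum.mpr hx
  have hsupp : v.support ⊆ F ×ˢ (s.disjSum s ×ˢ s.disjSum s) := by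
    intro p hp
    rw [Finset.mem_product, Finset.mem_product]
    refine ⟨Finset.mem_insert_of_mem (Finset.mem_image_of_mem _ hp), hmem _ ?_, hmem _ ?_⟩
    · exact Finset.mem_union_left _ (Finset.mem_image_of_mem (fun p => Sum.elim id id p.2.1) hp)
    · exact Finset.mem_union_right _ (Finset.mem_image_of_mem (fun p => Sum.elim id id p.2.2) hp)
  let a : ↥Λ →₀ Matrix (Fin s.card) (Fin s.card) ℂ :=
    Finsupp.onFinset (F.subtype (· ∈ Λ))
      (fun t => Matrix.of fun i j => v ((t : G), Sum.inr (e i), Sum.inl (e j))) (by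
        intro t ht
        rw [Finset.mem_subtype]
        by_contra hF
        apply ht
        ext i j
        by_contra hne
        apply hF
        have h1 := hsupp (Finsupp.mem_support_iff.mpr hne)
        exact (Finset.mem_product.mp h1).1)
  refine ⟨s.card, e, Matrix.of fun i j => v (1, Sum.inl (e i), Sum.inl (e j)),
    Matrix.of fun i j => v (1, Sum.inr (e i), Sum.inr (e j)), a,
    Subtype.val_injective.comp s.equivFin.symm.injective, fun c => ?_⟩
  rw [Finsupp.linearCombination_apply, Finsupp.sum_of_support_subset v hsupp _ (by simp)]
  rw [Finset.sum_product]
  simp only [Finset.sum_product, Finset.sum_disjSum, Finset.sum_add_distrib, hsum, smul_eq_mul]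
  have z1 : ∀ g i j, v (g, Sum.inl i, Sum.inr j) = 0 := by
    intro g i j
    apply hv
    simp [constrSet]
  have z2 : ∀ g, g ≠ 1 → ∀ i j, v (g, Sum.inl i, Sum.inl j) = 0 := by
    intro g hg i j
    apply hv
    simp [constrSet, hg]
  have z3 : ∀ g, g ≠ 1 → ∀ i j, v (g, Sum.inr i, Sum.inr j) = 0 := by
    intro g hg i j
    apply hv
    simp [constrSet, hg]
  have z4 : ∀ g, g ∉ Λ → ∀ i j, v (g, Sum.inr i, Sum.inl j) = 0 := by
    intro g hg i j
    apply hv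
    simp [constrSet, hg]
  have h1F : (1 : G) ∈ F := Finset.mem_insert_self _ _
  have e1 : ∑ g ∈ F, ∑ i, ∑ j, v (g, Sum.inl (e i), Sum.inl (e j)) *
      c (g, Sum.inl (e i), Sum.inl (e j)) =
      ∑ i, ∑ j, v (1, Sum.inl (e i), Sum.inl (e j)) * c (1, Sum.inl (e i), Sum.inl (e j)) :=
    Finset.sum_eq_single_of_mem 1 h1F (fun g _ hg => by simp [z2 g hg])
  have e2 : ∑ g ∈ F, ∑ i, ∑ j, v (g, Sum.inr (e i), Sum.inr (e j)) *
      c (g, Sum.inr (e i), Sum.inr (e j)) =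
      ∑ i, ∑ j, v (1, Sum.inr (e i), Sum.inr (e j)) * c (1, Sum.inr (e i), Sum.inr (e j)) :=
    Finset.sum_eq_single_of_mem 1 h1F (fun g _ hg => by simp [z3 g hg])
  have e3 : ∑ g ∈ F, ∑ i, ∑ j, v (g, Sum.inr (e i), Sum.inl (e j)) *
      c (g, Sum.inr (e i), Sum.inl (e j)) =
      ∑ t ∈ a.support, ∑ i, ∑ j, a t i j * c ((t : G), Sum.inr (e i), Sum.inl (e j)) := by
    have hs : a.support ⊆ F.subtype (· ∈ Λ) := Finsupp.support_onFinset_subset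
    rw [Finset.sum_subset hs]
    · rw [← Finset.sum_filter_of_ne (p := (· ∈ Λ)), ← Finset.subtype_map (· ∈ Λ), Finset.sum_map]
      · rfl
      · intro g _ hne
        by_contra hg
        apply hne
        simp [z4 g hg]
    · intro t _ ht
      rw [Finsupp.notMem_support_iff.mp ht]
      simp
  rw [e1, e2, e3]
  simp only [z1, zero_mul, Finset.sum_const_zero, Matrix.of_apply]
  ring

theorem constr_nonneg {Λ : Set G} {C : ℝ} (hS : IsCompletelySidon Λ C)
    {H : Type} [NormedAddCommGroup H] [InnerProductSpace ℂ H] [CompleteSpace H]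
    (z : ↥Λ → H →L[ℂ] H) (hz : ∀ t, ‖z t‖ ≤ 1) (b : ι → H)
    (v : (G × (ι ⊕ ι) × (ι ⊕ ι)) →₀ ℂ) (hv : ∀ p, p ∉ constrSet Λ ι → v p = 0)
    (hc : v ∈ posCone G (ι ⊕ ι)) :
    0 ≤ (Finsupp.linearCombination ℂ (constrVal Λ C z b) v).re := by
  classical
  obtain ⟨N, e, A, B, a, he, h⟩ := expand_supported Λ v hv
  have key := core_ineq hS A B a ?_ z hz (b ∘ e) (b ∘ e)
  · convert key using 2
    rw [h]
    simp only [constrVal, sform, bform, Function.comp, Finset.mul_sum]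
    congr 1
    · congr 1 <;> exact Finset.sum_congr rfl fun i _ => Finset.sum_congr rfl fun j _ => by ring
    · refine Finset.sum_congr rfl fun t _ => Finset.sum_congr rfl fun i _ =>
        Finset.sum_congr rfl fun j _ => ?_
      rw [dif_pos t.2]
  · intro K _ _ _ π x y
    have h1 := (mem_posCone v).mp hc K π
      (Sum.elim (Function.extend e y 0) (Function.extend e x 0))
    rw [h] at h1
    simpa only [sform, bform, repCoef, Sum.elim_inl, Sum.elim_inr, he.extend_apply, map_one,
      OneMemClass.coe_one, ContinuousLinearMap.one_apply] using h1

theorem posCone_cofinal (Λ : Set G) (v : (G × (ι ⊕ ι) × (ι ⊕ ι)) →₀ ℂ) :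
    ∃ w : (G × (ι ⊕ ι) × (ι ⊕ ι)) →₀ ℂ,
      (∀ p, p ∉ constrSet Λ ι → w p = 0) ∧ w + v ∈ posCone G (ι ⊕ ι) := by
  classical
  have hdiag : ∀ (i : ι ⊕ ι), (1, i, i) ∈ constrSet Λ ι := by
    rintro (i | i) <;> simp [constrSet]
  induction v using Finsupp.induction_linear with
  | zero => exact ⟨0, by simp, by simp⟩
  | add v v' h h' =>
    obtain ⟨w, hw, hc⟩ := h
    obtain ⟨w', hw', hc'⟩ := h'
    refine ⟨w + w', fun p hp => by simp [hw p hp, hw' p hp], ?_⟩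
    have := add_mem hc hc'
    rwa [add_add_add_comm] at this
  | single p r =>
    obtain ⟨g, i, j⟩ := p
    refine ⟨Finsupp.single (1, i, i) (‖r‖ : ℂ) + Finsupp.single (1, j, j) (‖r‖ : ℂ), ?_, ?_⟩
    · intro p hp
      have h1 : (1, i, i) ≠ p := fun h => hp (h ▸ hdiag i)
      have h2 : (1, j, j) ≠ p := fun h => hp (h ▸ hdiag j)
      simp [Finsupp.single_apply, h1, h2]
    · rw [mem_posCone]
      intro K _ _ _ π y
      simp only [map_add, Finsupp.linearCombination_single, repCoef, map_one, smul_eq_mul,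
        Complex.add_re, OneMemClass.coe_one, ContinuousLinearMap.one_apply]
      rw [inner_self_eq_norm_sq_to_K, inner_self_eq_norm_sq_to_K]
      have h1 : ‖r * inner ℂ (y i) (((π g : unitary (K →L[ℂ] K)) : K →L[ℂ] K) (y j))‖
          ≤ ‖r‖ * (‖y i‖ * ‖y j‖) := by
        rw [norm_mul]
        gcongr
        refine (norm_inner_le_norm _ _).trans ?_
        rw [ContinuousLinearMap.norm_map_of_mem_unitary (π g).2]
      have h2 := neg_le_of_abs_le (Complex.abs_re_le_norm
        (r * inner ℂ (y i) (((π g : unitary (K →L[ℂ] K)) : K →L[ℂ] K) (y j))))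
      have h3 : ∀ s : ℝ, ((‖r‖ : ℂ) * ((s : ℂ)) ^ 2).re = ‖r‖ * s ^ 2 := by
        intro s
        rw [← Complex.ofReal_pow, Complex.re_ofReal_mul, Complex.ofReal_re]
      have h4 := h3 ‖y i‖
      have h5 := h3 ‖y j‖
      erw [h4, h5]
      nlinarith [mul_nonneg (norm_nonneg r) (sq_nonneg (‖y i‖ - ‖y j‖)),
        mul_nonneg (norm_nonneg r) (sq_nonneg (‖y i‖ + ‖y j‖))]

end extension

theorem gns_extend {G : Type} [Group G] {E : Type} [SeminormedAddCommGroup E]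
    [InnerProductSpace ℂ E] (U : G → E →ₗ[ℂ] E)
    (hU : ∀ g x y, inner ℂ (U g x) (U g y) = inner ℂ x y)
    (h1 : ∀ x, U 1 x = x) (hm : ∀ g h x, U (g * h) x = U g (U h x)) :
    ∃ (K : Type) (_ : NormedAddCommGroup K) (_ : InnerProductSpace ℂ K) (_ : CompleteSpace K)
      (π : G →* unitary (K →L[ℂ] K)) (j : E → K),
      (∀ x y, inner ℂ (j x) (j y) = inner ℂ x y) ∧
      ∀ g x, ((π g : unitary (K →L[ℂ] K)) : K →L[ℂ] K) (j x) = j (U g x) := by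
  have hn : ∀ g x, ‖U g x‖ = ‖x‖ := by
    intro g x
    rw [@norm_eq_sqrt_re_inner ℂ, @norm_eq_sqrt_re_inner ℂ _ _ _ _ x, hU]
  let T : G → E →L[ℂ] E := fun g => (U g).mkContinuous 1 (fun x => by rw [hn, one_mul])
  let P : G → UniformSpace.Completion E →L[ℂ] UniformSpace.Completion E :=
    fun g => (T g).completion
  have hP : ∀ g (x : E), P g (x : UniformSpace.Completion E) =
      ((U g x : E) : UniformSpace.Completion E) := by
    intro g x
    exact ContinuousLinearMap.completion_apply_coe (T g) x
  have hP1 : P 1 = 1 := by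
    ext x
    induction x using UniformSpace.Completion.induction_on with
    | hp => exact isClosed_eq (P 1).continuous continuous_id
    | ih x => rw [hP, h1]; rfl
  have hPm : ∀ g h, P (g * h) = P g * P h := by
    intro g h
    ext x
    induction x using UniformSpace.Completion.induction_on with
    | hp => exact isClosed_eq (P (g * h)).continuous (P g * P h).continuous
    | ih x =>
      rw [hP, hm]
      change _ = P g (P h _)
      rw [hP, hP]
  have hPs : ∀ g, star (P g) = P g⁻¹ := by
    intro g
    symm
    rw [ContinuousLinearMap.star_eq_adjoint, ContinuousLinearMap.eq_adjoint_iff]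
    intro x y
    induction x, y using UniformSpace.Completion.induction_on₂ with
    | hp => exact isClosed_eq (by fun_prop) (by fun_prop)
    | ih x y =>
      rw [hP, hP, UniformSpace.Completion.inner_coe, UniformSpace.Completion.inner_coe,
        ← hU g (U g⁻¹ x) y, ← hm, mul_inv_cancel, h1]
  have hPu : ∀ g, P g ∈ unitary (UniformSpace.Completion E →L[ℂ] UniformSpace.Completion E) := by
    intro g
    rw [Unitary.mem_iff, hPs, ← hPm, ← hPm]
    simp [hP1]
  exact ⟨UniformSpace.Completion E, inferInstance, inferInstance, inferInstance,
    { toFun := fun g => ⟨P g, hPu g⟩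
      map_one' := Subtype.ext hP1
      map_mul' := fun g h => Subtype.ext (hPm g h) },
    fun x => (x : UniformSpace.Completion E),
    fun x y => UniformSpace.Completion.inner_coe x y, fun g x => hP g x⟩

/-- The form on finitely supported functions attached to a kernel. -/
noncomputable def kform {X : Type} (κ : X → X → ℂ) (x y : X →₀ ℂ) : ℂ :=
  x.sum fun a s => y.sum fun b t => starRingEnd ℂ s * t * κ a b

theorem kform_add_left {X : Type} (κ : X → X → ℂ) (x y w : X →₀ ℂ) :
    kform κ (x + y) w = kform κ x w + kform κ y w := by
  classical
  unfold kform
  rw [Finsupp.sum_add_index]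
  · intro a _; simp
  · intro a _ s t
    simp only [Finsupp.sum, ← Finset.sum_add_distrib]
    refine Finset.sum_congr rfl fun b _ => ?_
    rw [map_add]; ring

theorem kform_smul_left {X : Type} (κ : X → X → ℂ) (x y : X →₀ ℂ) (r : ℂ) :
    kform κ (r • x) y = starRingEnd ℂ r * kform κ x y := by
  unfold kform
  rw [Finsupp.sum_smul_index' (by simp)]
  simp only [Finsupp.sum, Finset.mul_sum, smul_eq_mul, map_mul, mul_assoc]

theorem kform_conj {X : Type} (κ : X → X → ℂ) (hκ : ∀ a b, starRingEnd ℂ (κ a b) = κ b a)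
    (x y : X →₀ ℂ) : starRingEnd ℂ (kform κ y x) = kform κ x y := by
  unfold kform
  rw [Finsupp.sum_comm]
  simp only [Finsupp.sum, map_sum, map_mul, hκ, RingHomCompTriple.comp_apply, RingHom.id_apply]
  refine Finset.sum_congr rfl fun b _ => Finset.sum_congr rfl fun a _ => ?_
  ring

theorem kform_single {X : Type} (κ : X → X → ℂ) (a b : X) :
    kform κ (Finsupp.single a 1) (Finsupp.single b 1) = κ a b := by
  unfold kform
  simp

theorem kform_mapDomain {X : Type} (κ : X → X → ℂ) (f : X → X)
    (hf : ∀ a b, κ (f a) (f b) = κ a b) (x y : X →₀ ℂ) :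
    kform κ (x.mapDomain f) (y.mapDomain f) = kform κ x y := by
  unfold kform
  rw [Finsupp.sum_mapDomain_index]
  · refine Finsupp.sum_congr fun a _ => ?_
    rw [Finsupp.sum_mapDomain_index]
    · simp only [hf]
    · intro b; simp
    · intro b s t; ring
  · intro a; simp
  · intro a s t
    simp only [Finsupp.sum, ← Finset.sum_add_distrib]
    refine Finset.sum_congr rfl fun b _ => ?_
    rw [map_add]; ring

theorem gns_kernel {G : Type} [Group G] {J : Type} (κ : G × J → G × J → ℂ)
    (herm : ∀ a b, starRingEnd ℂ (κ a b) = κ b a)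
    (pos : ∀ x : (G × J) →₀ ℂ, 0 ≤ (kform κ x x).re)
    (inv : ∀ (g : G) a b, κ (g * a.1, a.2) (g * b.1, b.2) = κ a b) :
    ∃ (K : Type) (_ : NormedAddCommGroup K) (_ : InnerProductSpace ℂ K) (_ : CompleteSpace K)
      (π : G →* unitary (K →L[ℂ] K)) (w : G × J → K),
      (∀ a b, inner ℂ (w a) (w b) = κ a b) ∧
      ∀ g a, ((π g : unitary (K →L[ℂ] K)) : K →L[ℂ] K) (w a) = w (g * a.1, a.2) := by
  let core : PreInnerProductSpace.Core ℂ ((G × J) →₀ ℂ) :=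
    { inner := kform κ
      conj_inner_symm := kform_conj κ herm
      re_inner_nonneg := pos
      add_left := kform_add_left κ
      smul_left := kform_smul_left κ }
  let : SeminormedAddCommGroup ((G × J) →₀ ℂ) :=
    @InnerProductSpace.Core.toSeminormedAddCommGroup ℂ _ _ _ _ core
  let : InnerProductSpace ℂ ((G × J) →₀ ℂ) := InnerProductSpace.ofCore core
  let U : G → ((G × J) →₀ ℂ) →ₗ[ℂ] ((G × J) →₀ ℂ) := fun g =>
    Finsupp.lmapDomain ℂ ℂ (fun a : G × J => (g * a.1, a.2))
  obtain ⟨K, i1, i2, i3, π, j, hj, hπ⟩ := gns_extend U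
    (fun g x y => kform_mapDomain κ _ (inv g) x y)
    (fun x => by
      simp only [U, Finsupp.lmapDomain_apply, one_mul, Prod.mk.eta]
      exact Finsupp.mapDomain_id)
    (fun g h x => by
      simp only [U, Finsupp.lmapDomain_apply, ← Finsupp.mapDomain_comp]
      congr 1
      funext a
      simp [mul_assoc])
  refine ⟨K, i1, i2, i3, π, fun a => j (Finsupp.single a 1), fun a b => ?_, fun g a => ?_⟩
  · rw [hj]; exact kform_single κ a b
  · rw [hπ]; simp [U, Finsupp.lmapDomain_apply, Finsupp.mapDomain_single]

section extension2
variable {G : Type} [Group G] {ι : Type}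

theorem exists_extension {Λ : Set G} {C : ℝ} (hS : IsCompletelySidon Λ C)
    {H : Type} [NormedAddCommGroup H] [InnerProductSpace ℂ H] [CompleteSpace H]
    (z : ↥Λ → H →L[ℂ] H) (hz : ∀ t, ‖z t‖ ≤ 1) (b : ι → H) :
    ∃ φ : G × (ι ⊕ ι) × (ι ⊕ ι) → ℂ,
      (∀ p ∈ constrSet Λ ι, φ p = constrVal Λ C z b p) ∧
      ∀ v ∈ posCone G (ι ⊕ ι), 0 ≤ (Finsupp.linearCombination ℂ φ v).re := by
  classical
  let D : Submodule ℝ ((G × (ι ⊕ ι) × (ι ⊕ ι)) →₀ ℂ) :=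
    { carrier := {v | ∀ p, p ∉ constrSet Λ ι → v p = 0}
      add_mem' := fun {v w} hv hw p hp => by simp [hv p hp, hw p hp]
      zero_mem' := fun p _ => rfl
      smul_mem' := fun c v hv p hp => by simp [hv p hp] }
  let F0 : ((G × (ι ⊕ ι) × (ι ⊕ ι)) →₀ ℂ) →ₗ[ℝ] ℝ :=
    Complex.reLm ∘ₗ (Finsupp.linearCombination ℂ (constrVal Λ C z b)).restrictScalars ℝ
  have hF0 : ∀ v, F0 v = (Finsupp.linearCombination ℂ (constrVal Λ C z b) v).re := fun v => rfl
  obtain ⟨f, hf1, hf2⟩ := riesz_extension (posCone G (ι ⊕ ι)) ⟨D, F0.domRestrict D⟩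
    (fun x hx => constr_nonneg hS z hz b x.1 x.2 hx)
    (fun y => by
      obtain ⟨w, hw, hc⟩ := posCone_cofinal Λ y
      exact ⟨⟨w, hw⟩, hc⟩)
  have hf1' : ∀ v ∈ D, f v = F0 v := fun v hv => hf1 ⟨v, hv⟩
  let φ : G × (ι ⊕ ι) × (ι ⊕ ι) → ℂ := fun p =>
    ⟨f (Finsupp.single p 1), - f (Finsupp.single p Complex.I)⟩
  have hsingle : ∀ p (a : ℂ), f (Finsupp.single p a) = (a * φ p).re := by
    intro p a
    have : Finsupp.single p a = a.re • Finsupp.single p (1 : ℂ) +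
        a.im • Finsupp.single p Complex.I := by
      rw [Finsupp.smul_single, Finsupp.smul_single, ← Finsupp.single_add]
      congr 1
      simp [Complex.re_add_im]
    rw [this, map_add, map_smul, map_smul]
    simp [φ, Complex.mul_re]
  have hφ : ∀ v, f v = (Finsupp.linearCombination ℂ φ v).re := by
    intro v
    induction v using Finsupp.induction_linear with
    | zero => simp
    | add v w hv hw => rw [map_add, map_add, Complex.add_re, hv, hw]
    | single p a => rw [hsingle, Finsupp.linearCombination_single, smul_eq_mul]
  refine ⟨φ, fun p hp => ?_, fun v hv => by rw [← hφ]; exact hf2 v hv⟩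
  have hmem : ∀ a : ℂ, Finsupp.single p a ∈ D := by
    intro a q hq
    have : p ≠ q := fun h => hq (h ▸ hp)
    simp [Finsupp.single_apply, this]
  have h1 : ∀ a : ℂ, (a * φ p).re = (a * constrVal Λ C z b p).re := by
    intro a
    rw [← hsingle, hf1' _ (hmem a), hF0, Finsupp.linearCombination_single, smul_eq_mul]
  apply Complex.ext
  · simpa using h1 1
  · simpa using h1 Complex.I

theorem herm_of_pos (φ : G × ι × ι → ℂ)
    (hφ : ∀ v ∈ posCone G ι, 0 ≤ (Finsupp.linearCombination ℂ φ v).re) (g : G) (i j : ι) :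
    starRingEnd ℂ (φ (g, i, j)) = φ (g⁻¹, j, i) := by
  have hrep : ∀ (K : Type) [NormedAddCommGroup K] [InnerProductSpace ℂ K] [CompleteSpace K]
      (π : G →* unitary (K →L[ℂ] K)) (y : ι → K),
      repCoef π y (g⁻¹, j, i) = starRingEnd ℂ (repCoef π y (g, i, j)) := by
    intro K _ _ _ π y
    simp only [repCoef, map_inv, inner_conj_symm]
    rw [← ContinuousLinearMap.adjoint_inner_left]
    congr 1
    rw [← ContinuousLinearMap.star_eq_adjoint]
    rw [← Unitary.star_eq_inv, Unitary.coe_star, star_star]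
  have h0 : ∀ a : ℂ, (a * φ (g, i, j)).re = (starRingEnd ℂ a * φ (g⁻¹, j, i)).re := by
    intro a
    have h1 := hφ (Finsupp.single (g, i, j) a - Finsupp.single (g⁻¹, j, i) (starRingEnd ℂ a)) (by
      rw [mem_posCone]
      intro K _ _ _ π y
      simp only [map_sub, Finsupp.linearCombination_single, hrep, smul_eq_mul]
      simp)
    have h2 := hφ (Finsupp.single (g⁻¹, j, i) (starRingEnd ℂ a) - Finsupp.single (g, i, j) a) (by
      rw [mem_posCone]
      intro K _ _ _ π y
      simp only [map_sub, Finsupp.linearCombination_single, hrep, smul_eq_mul]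
      simp)
    simp only [map_sub, Finsupp.linearCombination_single, smul_eq_mul, Complex.sub_re] at h1 h2
    linarith
  have h1 := h0 1
  have h2 := h0 Complex.I
  apply Complex.ext
  · simpa using h1
  · simpa using h2

theorem kernel_pos (φ : G × ι × ι → ℂ)
    (hφ : ∀ v ∈ posCone G ι, 0 ≤ (Finsupp.linearCombination ℂ φ v).re) (x : (G × ι) →₀ ℂ) :
    0 ≤ (kform (fun a b : G × ι => φ (a.1⁻¹ * b.1, a.2, b.2)) x x).re := by
  let v : (G × ι × ι) →₀ ℂ := ∑ a ∈ x.support, ∑ b ∈ x.support,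
    Finsupp.single (a.1⁻¹ * b.1, a.2, b.2) (starRingEnd ℂ (x a) * x b)
  have hv : ∀ c : G × ι × ι → ℂ, Finsupp.linearCombination ℂ c v =
      kform (fun a b : G × ι => c (a.1⁻¹ * b.1, a.2, b.2)) x x := by
    intro c
    simp only [v, map_sum, Finsupp.linearCombination_single, smul_eq_mul, kform, Finsupp.sum]
  rw [← hv]
  apply hφ
  rw [mem_posCone]
  intro K _ _ _ π y
  rw [hv]
  have h : kform (fun a b : G × ι => repCoef π y (a.1⁻¹ * b.1, a.2, b.2)) x x =
      inner ℂ (∑ a ∈ x.support, x a • ((π a.1 : unitary (K →L[ℂ] K)) : K →L[ℂ] K) (y a.2))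
        (∑ a ∈ x.support, x a • ((π a.1 : unitary (K →L[ℂ] K)) : K →L[ℂ] K) (y a.2)) := by
    simp only [kform, Finsupp.sum, sum_inner, inner_sum, inner_smul_left, inner_smul_right,
      Finset.mul_sum]
    rw [Finset.sum_comm]
    refine Finset.sum_congr rfl fun a _ => ?_
    refine Finset.sum_congr rfl fun b _ => ?_
    simp only [repCoef, map_mul, map_inv]
    rw [← ContinuousLinearMap.adjoint_inner_right, ← ContinuousLinearMap.star_eq_adjoint,
      ← Unitary.star_eq_inv]
    simp only [Submonoid.coe_mul, Unitary.coe_star, ContinuousLinearMap.mul_apply]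
    ring
  rw [h]
  exact inner_self_nonneg (𝕜 := ℂ)

end extension2

theorem exists_basis_map {H K ι : Type} [NormedAddCommGroup H] [InnerProductSpace ℂ H]
    [CompleteSpace H] [NormedAddCommGroup K] [InnerProductSpace ℂ K] [CompleteSpace K]
    (b : HilbertBasis ι ℂ H) (C : ℝ) (hC : 1 ≤ C) (w : ι → K)
    (hw : ∀ i j, inner ℂ (w i) (w j) = C * inner ℂ (b i) (b j)) :
    ∃ ξ : H →L[ℂ] K, ‖ξ‖ ≤ √C ∧ ∀ i, ξ (b i) = w i := by
  have hC0 : 0 < √C := Real.sqrt_pos.mpr (by linarith)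
  have hne : ((√C : ℝ) : ℂ) ≠ 0 := by exact_mod_cast hC0.ne'
  have hsq : ((√C : ℝ) : ℂ) * ((√C : ℝ) : ℂ) = C := by
    rw [← Complex.ofReal_mul, Real.mul_self_sqrt (by linarith)]
  let u : ι → K := fun i => ((√C : ℝ) : ℂ)⁻¹ • w i
  have hu : Orthonormal ℂ u := by
    classical
    rw [orthonormal_iff_ite]
    intro i j
    simp only [u, inner_smul_left, inner_smul_right, hw]
    rw [orthonormal_iff_ite.mp b.orthonormal i j, map_inv₀, Complex.conj_ofReal, ← hsq]
    split_ifs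
    · field_simp
    · simp
  let T : H →ₗᵢ[ℂ] K := hu.orthogonalFamily.linearIsometry.comp b.repr.toLinearIsometry
  have hT : ∀ i, T (b i) = u i := by
    intro i
    classical
    change hu.orthogonalFamily.linearIsometry (b.repr (b i)) = u i
    rw [b.repr_self]
    erw [OrthogonalFamily.linearIsometry_apply_single]
    simp [LinearIsometry.toSpanSingleton_apply]
  refine ⟨((√C : ℝ) : ℂ) • T.toContinuousLinearMap, ?_, fun i => ?_⟩
  · rw [norm_smul, Complex.norm_real, Real.norm_of_nonneg hC0.le]
    have := T.norm_toContinuousLinearMap_le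
    nlinarith
  · change ((√C : ℝ) : ℂ) • T (b i) = w i
    rw [hT, smul_smul, mul_inv_cancel₀ hne, one_smul]

theorem hard_direction {G : Type} [Group G] (Λ : Set G) (C : ℝ) (hC : 1 ≤ C)
    (hS : IsCompletelySidon Λ C)
    (H : Type) [NormedAddCommGroup H] [InnerProductSpace ℂ H] [CompleteSpace H]
    (z : ↥Λ → H →L[ℂ] H) (hz : ∀ t, ‖z t‖ ≤ 1) :
    ∃ (K : Type) (_ : NormedAddCommGroup K) (_ : InnerProductSpace ℂ K) (_ : CompleteSpace K)
      (π : G →* unitary (K →L[ℂ] K)) (ξ η : H →L[ℂ] K),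
      ‖ξ‖ * ‖η‖ ≤ C ∧
      ∀ t : ↥Λ,
        (ContinuousLinearMap.adjoint η).comp
          (((π (t : G) : unitary (K →L[ℂ] K)) : K →L[ℂ] K).comp ξ) = z t := by
  obtain ⟨s, b, -⟩ := exists_hilbertBasis ℂ H
  obtain ⟨φ, hφ1, hφ2⟩ := exists_extension hS z hz (fun i => b i)
  obtain ⟨K, i1, i2, i3, π, w, hw, hπ⟩ := gns_kernel
    (fun a c : G × (s ⊕ s) => φ (a.1⁻¹ * c.1, a.2, c.2))
    (fun a c => by
      rw [herm_of_pos φ hφ2]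
      simp)
    (kernel_pos φ hφ2)
    (fun g a c => by simp [mul_assoc])
  obtain ⟨ξ, hξ, hξb⟩ := exists_basis_map b C hC (fun i => w (1, Sum.inl i)) (fun i j => by
    rw [hw]
    simp only [inv_one, mul_one]
    rw [hφ1 _ (Or.inl ⟨i, j, rfl⟩)]
    rfl)
  obtain ⟨η, hη, hηb⟩ := exists_basis_map b C hC (fun i => w (1, Sum.inr i)) (fun i j => by
    rw [hw]
    simp only [inv_one, mul_one]
    rw [hφ1 _ (Or.inr (Or.inl ⟨i, j, rfl⟩))]
    rfl)
  refine ⟨K, i1, i2, i3, π, ξ, η, ?_, fun t => ?_⟩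
  · calc ‖ξ‖ * ‖η‖ ≤ √C * √C := by gcongr
      _ = C := Real.mul_self_sqrt (by linarith)
  · apply ContinuousLinearMap.ext_on
      (s := Set.range b) (Submodule.dense_iff_topologicalClosure_eq_top.mpr b.dense_span)
    rintro _ ⟨j, rfl⟩
    apply b.repr.injective
    ext i
    rw [b.repr_apply_apply, b.repr_apply_apply]
    simp only [ContinuousLinearMap.comp_apply]
    rw [ContinuousLinearMap.adjoint_inner_right, hξb, hηb, hπ, hw]
    simp only [inv_one, one_mul, mul_one]
    rw [hφ1 _ (Or.inr (Or.inr ⟨t, t.2, i, j, rfl⟩))]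
    simp [constrVal]


theorem isCompletelySidon_iff_operatorValued_interpolation {G : Type} [Group G] (Λ : Set G)
    (C : ℝ) (hC : 1 ≤ C) :
    IsCompletelySidon Λ C ↔
      ∀ (H : Type) [NormedAddCommGroup H] [InnerProductSpace ℂ H] [CompleteSpace H]
        (z : ↥Λ → H →L[ℂ] H), (∀ t, ‖z t‖ ≤ 1) →
        ∃ (K : Type) (_ : NormedAddCommGroup K) (_ : InnerProductSpace ℂ K) (_ : CompleteSpace K)
          (π : G →* unitary (K →L[ℂ] K)) (ξ η : H →L[ℂ] K),
          ‖ξ‖ * ‖η‖ ≤ C ∧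
          ∀ t : ↥Λ,
            (ContinuousLinearMap.adjoint η).comp
              (((π (t : G) : unitary (K →L[ℂ] K)) : K →L[ℂ] K).comp ξ) = z t := by
  exact ⟨fun hS H _ _ _ z hz => hard_direction Λ C hC hS H z hz, easy_direction Λ C⟩
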